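/- Let α, β be nonzero real numbers, and suppose at least one of α, β is rational. Let f : ℝ → ℂ be measurable, with d₁,d₂,d₃,d₄ ∈ ℂ not all zero satisfying d₁f(x) + d₂f(x+1) + d₃f(x)e^{2πiαx} + d₄f(x+1)e^{2πiβx} = 0 for almost every x ∈ ℝ, and suppose f has minimal decay: for almost every x ∈ ℝ, f(x+n) → 0 as n → +∞ and as n → −∞ along the integers. Then f = 0 almost everywhere. -/

import Mathlib

open MeasureTheory Filter

/-- `e x = e^{2πix}`. -/
noncomputable def e (x : ℝ) : ℂ := Complex.exp (2 * Real.pi * Complex.I * x)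

section Cocycle

variable {G : Type*} [AddCommGroup G] [MeasurableSpace G] [MeasurableAdd G]
  (μ : Measure G) [μ.IsAddRightInvariant] [IsFiniteMeasure μ]

/-- Over a finite invariant measure, the ergodic sums of a function along a translation and along
its inverse have the same distribution, so they cannot diverge to opposite infinities. -/
theorem ae_not_tendsto_translate_sums {φ : G → ℝ} (hφ : Measurable φ) (θ : G) :
    ∀ᵐ y ∂μ, ¬ (Tendsto (fun n : ℕ ↦ ∑ k ∈ Finset.range n, φ (y + k • θ)) atTop atTop ∧
      Tendsto (fun n : ℕ ↦ ∑ k ∈ Finset.range n, φ (y - n • θ + k • θ)) atTop atBot) := by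
  let S : ℕ → G → ℝ := fun n y ↦ ∑ k ∈ Finset.range n, φ (y + k • θ)
  let F : Set G := {y | Tendsto (fun n ↦ S n y) atTop atTop ∧
    Tendsto (fun n ↦ S n (y - n • θ)) atTop atBot}
  have hS (n : ℕ) : Measurable (S n) :=
    Finset.measurable_sum _ fun k _ ↦ hφ.comp (measurable_add_const _)
  have hS' (n : ℕ) : Measurable fun y ↦ S n (y - n • θ) := by
    simpa only [sub_eq_add_neg, Function.comp_def] using (hS n).comp (measurable_add_const (-(n • θ)))
  have hF : MeasurableSet F := (measurableSet_tendsto _ hS).inter (measurableSet_tendsto _ hS')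
  have hstep (y : G) (hy : y ∈ F) : y + θ ∈ F := by
    constructor
    · have h := tendsto_atTop_add_const_right atTop (-φ y) (hy.1.comp (tendsto_add_atTop_nat 1))
      refine h.congr fun n ↦ ?_
      simp only [S, Function.comp_apply, Finset.sum_range_succ' _ n, zero_smul, add_zero,
        add_neg_cancel_right]
      refine Finset.sum_congr rfl fun k _ ↦ ?_
      rw [succ_nsmul']; abel_nf
    · rw [← tendsto_add_atTop_iff_nat 1]
      refine (tendsto_atBot_add_const_right atTop (φ y) hy.2).congr fun n ↦ ?_
      simp only [S, Finset.sum_range_succ _ n]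
      congr 1
      · refine Finset.sum_congr rfl fun k _ ↦ ?_
        rw [succ_nsmul]; abel_nf
      · rw [succ_nsmul]; abel_nf
  have hshift (n : ℕ) (y : G) (hy : y ∈ F) : y + n • θ ∈ F := by
    induction n with
    | zero => simpa using hy
    | succ n ih => rw [succ_nsmul, ← add_assoc]; exact hstep _ ih
  have hpos : Tendsto (fun n ↦ μ (F ∩ {y | 0 < S n y})) atTop (nhds (μ F)) := by
    refine tendsto_measure_of_tendsto_indicator_of_isFiniteMeasure (L := atTop) μ
      (fun n ↦ hF.inter (measurableSet_lt measurable_const (hS n))) fun y ↦ ?_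
    by_cases hy : y ∈ F
    · filter_upwards [hy.1.eventually_gt_atTop 0] with n hn
      simp [hy, hn]
    · simp [hy]
  have hneg : Tendsto (fun n ↦ μ (F ∩ {y | 0 < S n (y - n • θ)})) atTop (nhds (μ ∅)) := by
    refine tendsto_measure_of_tendsto_indicator_of_isFiniteMeasure (L := atTop) μ
      (fun n ↦ hF.inter (measurableSet_lt measurable_const (hS' n))) fun y ↦ ?_
    by_cases hy : y ∈ F
    · filter_upwards [hy.2.eventually_lt_atBot 0] with n hn
      simp [hn.le]
    · simp [hy]
  have hle (n : ℕ) : μ (F ∩ {y | 0 < S n y}) ≤ μ (F ∩ {y | 0 < S n (y - n • θ)}) := by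
    rw [← measure_preimage_add_right μ (n • θ) (F ∩ {y | 0 < S n (y - n • θ)})]
    refine measure_mono fun y hy ↦ ⟨hshift n y hy.1, ?_⟩
    simpa using hy.2
  have hzero : μ F = 0 := by
    simpa using le_of_tendsto_of_tendsto' hpos hneg hle
  rw [ae_iff]
  simpa only [not_not] using hzero

/-- The ergodic sums of a function along a translation and along its inverse cannot diverge to
opposite infinities after removing any constant drift, off a null set independent of the drift. -/
theorem ae_forall_not_tendsto_translate_sums {φ : G → ℝ} (hφ : Measurable φ) (θ : G) :
    ∀ᵐ y ∂μ, ∀ c : ℝ,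
      ¬ (Tendsto (fun n : ℕ ↦ ∑ k ∈ Finset.range n, φ (y + k • θ) - n * c) atTop atTop ∧
      Tendsto (fun n : ℕ ↦ ∑ k ∈ Finset.range n, φ (y - n • θ + k • θ) - n * c) atTop atBot) := by
  classical
  let S : ℕ → G → ℝ := fun n y ↦ ∑ k ∈ Finset.range n, φ (y + k • θ)
  let F : ℝ → Set G := fun r ↦ {y | Tendsto (fun n ↦ S n y - n * r) atTop atTop}
  have hS (n : ℕ) : Measurable (S n) :=
    Finset.measurable_sum _ fun k _ ↦ hφ.comp (measurable_add_const _)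
  have hF (r : ℝ) : MeasurableSet (F r) :=
    measurableSet_tendsto _ fun n ↦ (hS n).sub_const _
  have hstep (r : ℝ) (y : G) : y + θ ∈ F r ↔ y ∈ F r := by
    have h (n : ℕ) : S (n + 1) y - (n + 1 : ℕ) * r = S n (y + θ) - n * r + (φ y - r) := by
      have : S (n + 1) y = S n (y + θ) + φ y := by
        simp only [S, Finset.sum_range_succ' _ n, zero_smul, add_zero]
        congr 1
        refine Finset.sum_congr rfl fun k _ ↦ ?_
        rw [succ_nsmul']; abel_nf
      rw [this]; push_cast; ring
    simp only [F, Set.mem_ofPred_eq]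
    rw [← tendsto_add_atTop_iff_nat (f := fun n ↦ S n y - n * r) 1]
    simp only [h]
    exact ⟨tendsto_atTop_add_const_right _ _, fun h' ↦ by
      simpa only [add_neg_cancel_right] using
        tendsto_atTop_add_const_right _ (-(φ y - r)) h'⟩
  let s : G → EReal := fun y ↦ ⨆ r : ℚ, if y ∈ F r then ((r : ℝ) : EReal) else ⊥
  have hs : Measurable s :=
    Measurable.iSup fun r ↦ Measurable.ite (hF r) measurable_const measurable_const
  have hs_shift (n : ℕ) (y : G) : s (y + n • θ) = s y := by
    induction n with
    | zero => simp
    | succ n ih => rw [← ih, succ_nsmul, ← add_assoc]; simp only [s, hstep]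
  have hφs : Measurable fun y ↦ φ y - (s y).toReal := hφ.sub hs.ereal_toReal
  have hrat := ae_all_iff.2 fun r : ℚ ↦
    ae_not_tendsto_translate_sums μ (hφ.sub_const (r : ℝ)) θ
  filter_upwards [hrat, ae_not_tendsto_translate_sums μ hφs θ] with y hy hys c ⟨hc, hc'⟩
  have hle : (c : EReal) ≤ s y := by
    refine le_of_forall_lt fun a ha ↦ ?_
    obtain ⟨r, har, hrc⟩ := EReal.lt_iff_exists_rat_btwn.1 ha
    refine har.trans_le ?_
    have hr : y ∈ F r := by
      refine tendsto_atTop_mono (fun n ↦ ?_) hc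
      have : (r : ℝ) ≤ c := (EReal.coe_lt_coe_iff.1 hrc).le
      gcongr
    exact (if_pos hr).ge.trans (le_iSup (fun r : ℚ ↦ if y ∈ F r then ((r : ℝ) : EReal) else ⊥) r)
  have hge : s y ≤ c := by
    refine iSup_le fun r ↦ ?_
    split_ifs with hr
    · rw [EReal.coe_le_coe_iff]
      by_contra! hlt
      refine hy r ⟨by simpa [F, S] using hr, ?_⟩
      refine tendsto_atBot_mono (fun n ↦ ?_) hc'
      simp only [Finset.sum_sub_distrib, Finset.sum_const, Finset.card_range, nsmul_eq_mul]
      gcongr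
    · exact bot_le
  have hsc : (s y).toReal = c := by rw [le_antisymm hge hle, EReal.toReal_coe]
  have hback (n : ℕ) : s (y - n • θ) = s y := by
    rw [← hs_shift n (y - n • θ), sub_add_cancel]
  refine hys ⟨?_, ?_⟩
  · simpa [hs_shift, hsc] using hc
  · simpa [hs_shift, hback, hsc] using hc'

end Cocycle

theorem toCircle_coe_eq_e (x : ℝ) : (AddCircle.toCircle (x : UnitAddCircle) : ℂ) = e x := by
  rw [AddCircle.toCircle_apply_mk, Circle.coe_exp, e]
  congr 1
  push_cast
  ring

theorem e_add (x y : ℝ) : e (x + y) = e x * e y := by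
  simp only [e, ← Complex.exp_add]
  congr 1
  push_cast
  ring

theorem e_intCast (n : ℤ) : e n = 1 := by
  rw [e, Complex.exp_eq_one_iff]
  exact ⟨n, by push_cast; ring⟩

theorem ae_unitAddCircle_coe {p : UnitAddCircle → Prop} (hp : ∀ᵐ y, p y) :
    ∀ᵐ x : ℝ, p x := by
  have h (n : ℤ) : ∀ᵐ x : ℝ ∂(volume.restrict (Set.Ioc (n : ℝ) (n + 1))), p (x : UnitAddCircle) :=
    (UnitAddCircle.measurePreserving_mk n).quasiMeasurePreserving.ae hp
  rw [← Measure.restrict_univ (μ := (volume : Measure ℝ)), ← iUnion_Ioc_intCast ℝ]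
  refine (ae_restrict_iUnion_iff _ _).2 ?_
  exact h

theorem ae_comp_const_mul {p : ℝ → Prop} (hp : ∀ᵐ x, p x) {c : ℝ} (hc : c ≠ 0) :
    ∀ᵐ x, p (c * x) :=
  (Measure.quasiMeasurePreserving_smul volume hc).ae hp

theorem ae_forall_int_translate {p : ℝ → Prop} (hp : ∀ᵐ x, p x) :
    ∀ᵐ x, ∀ n : ℤ, p (x + n) :=
  ae_all_iff.2 fun n ↦ (measurePreserving_add_right volume (n : ℝ)).quasiMeasurePreserving.ae hp

theorem ae_add_mul_e_ne_zero {a b : ℂ} (hab : a ≠ 0 ∨ b ≠ 0) {γ : ℝ} (hγ : γ ≠ 0) :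
    ∀ᵐ x : ℝ, a + b * e (γ * x) ≠ 0 := by
  by_cases hb : b = 0
  · subst hb
    simpa using hab
  by_cases hx₀ : ∃ x₀, a + b * e (γ * x₀) = 0
  swap
  · push Not at hx₀
    exact .of_forall hx₀
  obtain ⟨x₀, hx₀⟩ := hx₀
  have hcount : (Set.range fun n : ℤ ↦ x₀ + n / γ).Countable := Set.countable_range _
  filter_upwards [hcount.ae_notMem volume] with x hx h
  have heq : e (γ * x) = e (γ * x₀) := mul_left_cancel₀ hb (add_left_cancel (h.trans hx₀.symm))
  obtain ⟨n, hn⟩ := Complex.exp_eq_exp_iff_exists_int.1 heq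
  refine hx ⟨n, ?_⟩
  have h2 : (2 * Real.pi * Complex.I : ℂ) ≠ 0 := Complex.two_pi_I_ne_zero
  have hn' : ((γ * x : ℝ) : ℂ) = ((γ * x₀ + n : ℝ) : ℂ) := by
    apply mul_left_cancel₀ h2
    rw [hn]
    push_cast
    ring
  have := Complex.ofReal_injective hn'
  field_simp
  linarith

/-- A nonzero two-sided solution of `u n * a = u (n + 1) * b n` that vanishes at both infinities
forces the sums of `log ‖b‖ - log ‖a‖` to diverge to `+∞` forwards and to `-∞` backwards. -/
theorem tendsto_log_sums_of_recurrence {u b : ℤ → ℂ} {a : ℂ} (ha : a ≠ 0) (hb : ∀ n, b n ≠ 0)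
    (hu : ∀ n, u n * a = u (n + 1) * b n) (h0 : u 0 ≠ 0)
    (htop : Tendsto u atTop (nhds 0)) (hbot : Tendsto u atBot (nhds 0)) :
    Tendsto (fun n : ℕ ↦ ∑ k ∈ Finset.range n, Real.log ‖b k‖ - n * Real.log ‖a‖) atTop atTop ∧
    Tendsto (fun n : ℕ ↦ ∑ k ∈ Finset.range n, Real.log ‖b (-n + k)‖ - n * Real.log ‖a‖)
      atTop atBot := by
  have hiff (n : ℤ) : u (n + 1) = 0 ↔ u n = 0 := by
    have := hu n
    constructor
    · intro h
      exact (mul_eq_zero.1 (this.trans (by rw [h, zero_mul]))).resolve_right ha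
    · intro h
      exact (mul_eq_zero.1 (this.symm.trans (by rw [h, zero_mul]))).resolve_right (hb n)
  have hne (n : ℤ) : u n ≠ 0 := by
    induction n using Int.induction_on with
    | zero => exact h0
    | succ n ih => exact (hiff n).not.2 ih
    | pred n ih => exact (hiff _).not.1 (by simpa using ih)
  have hlog (n : ℤ) :
      Real.log ‖b n‖ - Real.log ‖a‖ = Real.log ‖u n‖ - Real.log ‖u (n + 1)‖ := by
    have := congrArg (fun z ↦ Real.log ‖z‖) (hu n)
    simp only [norm_mul] at this
    rw [Real.log_mul (norm_ne_zero_iff.2 (hne _)) (norm_ne_zero_iff.2 ha),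
      Real.log_mul (norm_ne_zero_iff.2 (hne _)) (norm_ne_zero_iff.2 (hb n))] at this
    linarith
  have hsum (m : ℤ) (n : ℕ) :
      ∑ k ∈ Finset.range n, Real.log ‖b (m + k)‖ - n * Real.log ‖a‖
        = Real.log ‖u m‖ - Real.log ‖u (m + n)‖ := by
    induction n with
    | zero => simp
    | succ n ih =>
      have := hlog (m + n)
      rw [Finset.sum_range_succ]
      push_cast
      rw [← add_assoc]
      linarith
  have hlim {l : Filter ℤ} (hl : Tendsto u l (nhds 0)) :
      Tendsto (fun n ↦ Real.log ‖u n‖) l atBot :=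
    Real.tendsto_log_nhdsNE_zero.comp <| tendsto_nhdsWithin_iff.2
      ⟨by simpa using hl.norm, .of_forall fun n ↦ norm_ne_zero_iff.2 (hne n)⟩
  constructor
  · have h := (hlim htop).comp tendsto_natCast_atTop_atTop
    refine (tendsto_atTop_add_const_left _ (Real.log ‖u 0‖) (tendsto_neg_atBot_atTop.comp h)).congr
      fun n ↦ ?_
    simpa [sub_eq_add_neg] using (hsum 0 n).symm
  · have h := (hlim hbot).comp (tendsto_neg_atTop_atBot.comp tendsto_natCast_atTop_atTop)
    refine (tendsto_atBot_add_const_right _ (-Real.log ‖u 0‖) h).congr fun n ↦ ?_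
    simpa [sub_eq_add_neg] using (hsum (-n) n).symm

/-- A recurrence `f x * A x = f (x + q) * b (β x)` with `q`-periodic `A` and `1`-periodic `b` has no
nontrivial solution with minimal decay. -/
theorem ae_eq_zero_of_periodic_recurrence {f A : ℝ → ℂ} {b : UnitAddCircle → ℂ}
    (hb : Measurable b) {β : ℝ} (hβ : β ≠ 0) {q : ℕ} (hq : 0 < q)
    (hA_period : ∀ (x : ℝ) (n : ℤ), A (x + (n * q : ℤ)) = A x)
    (hA : ∀ᵐ x, A x ≠ 0) (hb0 : ∀ᵐ x : ℝ, b (β * x : ℝ) ≠ 0)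
    (heq : ∀ᵐ x : ℝ, f x * A x = f (x + q) * b (β * x : ℝ))
    (hdecay : ∀ᵐ x : ℝ, Tendsto (fun n : ℤ => f (x + n)) atTop (nhds 0) ∧
      Tendsto (fun n : ℤ => f (x + n)) atBot (nhds 0)) :
    ∀ᵐ x : ℝ, f x = 0 := by
  have hφ : Measurable fun y ↦ Real.log ‖b y‖ := hb.norm.log
  have hsums := ae_comp_const_mul (ae_unitAddCircle_coe
    (ae_forall_not_tendsto_translate_sums volume hφ ((β * q : ℝ) : UnitAddCircle))) hβ
  filter_upwards [ae_forall_int_translate heq, hdecay, hA, ae_forall_int_translate hb0, hsums]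
    with x hx hlim hA hb0 hy
  by_contra hfx
  have hmul : Tendsto (fun n : ℤ ↦ n * (q : ℤ)) atTop atTop :=
    tendsto_id.atTop_mul_const' (by exact_mod_cast hq)
  have hmul' : Tendsto (fun n : ℤ ↦ n * (q : ℤ)) atBot atBot :=
    tendsto_id.atBot_mul_const' (by exact_mod_cast hq)
  have hrec (n : ℤ) : f (x + (n * q : ℤ)) * A x
      = f (x + ((n + 1) * q : ℤ)) * b (β * (x + (n * q : ℤ)) : ℝ) := by
    have h : x + ((n + 1) * q : ℤ) = x + (n * q : ℤ) + q := by push_cast; ring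
    rw [h, ← hx, hA_period]
  obtain ⟨htop, hbot⟩ := tendsto_log_sums_of_recurrence
    (u := fun n ↦ f (x + (n * q : ℤ))) (b := fun n ↦ b (β * (x + (n * q : ℤ)) : ℝ))
    hA (fun n ↦ hb0 (n * q)) hrec (by simpa using hfx) (hlim.1.comp hmul) (hlim.2.comp hmul')
  have hforward (k : ℕ) : ((β * (x + ((k : ℤ) * q : ℤ)) : ℝ) : UnitAddCircle)
      = (β * x : ℝ) + k • ((β * q : ℝ) : UnitAddCircle) := by
    rw [← AddCircle.coe_nsmul, ← AddCircle.coe_add, nsmul_eq_mul]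
    push_cast
    ring_nf
  have hbackward (n k : ℕ) : ((β * (x + ((-n + k : ℤ) * q : ℤ)) : ℝ) : UnitAddCircle)
      = (β * x : ℝ) - n • ((β * q : ℝ) : UnitAddCircle) + k • ((β * q : ℝ) : UnitAddCircle) := by
    rw [← AddCircle.coe_nsmul, ← AddCircle.coe_nsmul, ← AddCircle.coe_sub, ← AddCircle.coe_add,
      nsmul_eq_mul, nsmul_eq_mul]
    push_cast
    ring_nf
  simp only [hforward] at htop
  simp only [hbackward] at hbot
  exact hy _ ⟨htop, hbot⟩

/-- The special (2,2) configuration with rational first frequency `α`. -/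
theorem ae_eq_zero_of_rational_frequency
    {α β : ℝ} (hα : α ≠ 0) (hβ : β ≠ 0) (hrat : ∃ q : ℚ, (q : ℝ) = α) {f : ℝ → ℂ}
    (d : Fin 4 → ℂ) (hd : ∃ i, d i ≠ 0)
    (heq : ∀ᵐ x : ℝ, d 0 * f x + d 1 * f (x + 1) + d 2 * f x * e (α * x)
      + d 3 * f (x + 1) * e (β * x) = 0)
    (hdecay : ∀ᵐ x : ℝ, Tendsto (fun n : ℤ => f (x + n)) atTop (nhds 0) ∧
      Tendsto (fun n : ℤ => f (x + n)) atBot (nhds 0)) :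
    ∀ᵐ x : ℝ, f x = 0 := by
  by_cases h02 : d 0 = 0 ∧ d 2 = 0
  · have h13 : d 1 ≠ 0 ∨ d 3 ≠ 0 := by
      by_contra! h
      obtain ⟨i, hi⟩ := hd
      fin_cases i <;> simp_all
    have h : ∀ᵐ x : ℝ, f (x + 1) = 0 := by
      filter_upwards [heq, ae_add_mul_e_ne_zero h13 hβ] with x hx hb
      have : f (x + 1) * (d 1 + d 3 * e (β * x)) = 0 := by
        rw [← hx, h02.1, h02.2]; ring
      exact (mul_eq_zero.1 this).resolve_right hb
    filter_upwards [ae_forall_int_translate h] with x hx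
    simpa using hx (-1)
  by_cases h13 : d 1 = 0 ∧ d 3 = 0
  · filter_upwards [heq, ae_add_mul_e_ne_zero (not_and_or.1 h02) hα] with x hx ha
    have : f x * (d 0 + d 2 * e (α * x)) = 0 := by
      rw [← hx, h13.1, h13.2]; ring
    exact (mul_eq_zero.1 this).resolve_right ha
  obtain ⟨r, hr⟩ := hrat
  let q : ℕ := r.den
  have hq : 0 < q := r.den_pos
  have hαq : α * q = r.num := by
    rw [← hr]; exact_mod_cast r.mul_den_eq_num
  let A : ℝ → ℂ := fun x ↦ d 0 + d 2 * e (α * x)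
  let B : ℝ → ℂ := fun x ↦ -(d 1 + d 3 * e (β * x))
  let b : UnitAddCircle → ℂ := fun y ↦
    ∏ j ∈ Finset.range q, -(d 1 + d 3 * (AddCircle.toCircle (y + ((β * j : ℝ) : UnitAddCircle))))
  have hb_meas : Measurable b := by
    refine Continuous.measurable (continuous_finsetProd _ fun j _ ↦ ?_)
    have := AddCircle.continuous_toCircle (T := (1 : ℝ))
    fun_prop
  have hbB (x : ℝ) : b ((β * x : ℝ) : UnitAddCircle) = ∏ j ∈ Finset.range q, B (x + j) := by
    refine Finset.prod_congr rfl fun j _ ↦ ?_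
    rw [← AddCircle.coe_add, toCircle_coe_eq_e, ← mul_add]
  have hA_period (x : ℝ) (n : ℤ) : A (x + (n * q : ℤ)) = A x := by
    have h : α * (x + (n * q : ℤ)) = α * x + ((n * r.num : ℤ) : ℝ) := by
      push_cast
      rw [← hαq]; ring
    simp only [A, h, e_add, e_intCast, mul_one]
  refine ae_eq_zero_of_periodic_recurrence (A := fun x ↦ ∏ j ∈ Finset.range q, A (x + j))
    hb_meas hβ hq (fun x n ↦ ?_) ?_ ?_ ?_ hdecay
  · refine Finset.prod_congr rfl fun j _ ↦ ?_
    rw [add_right_comm, hA_period]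
  · filter_upwards [ae_forall_int_translate (ae_add_mul_e_ne_zero (not_and_or.1 h02) hα)] with x hx
    exact Finset.prod_ne_zero_iff.2 fun j _ ↦ by simpa using hx j
  · filter_upwards [ae_forall_int_translate (ae_add_mul_e_ne_zero (not_and_or.1 h13) hβ)] with x hx
    rw [hbB]
    exact Finset.prod_ne_zero_iff.2 fun j _ ↦ neg_ne_zero.2 (by simpa using hx j)
  · filter_upwards [ae_forall_int_translate heq] with x hx
    rw [hbB]
    have hstep (k : ℕ) : f x * ∏ j ∈ Finset.range k, A (x + j)
        = f (x + k) * ∏ j ∈ Finset.range k, B (x + j) := by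
      induction k with
      | zero => simp
      | succ k ih =>
        have h : f (x + k) * A (x + k) = f (x + (k + 1 : ℕ)) * B (x + k) := by
          have h := hx k
          rw [Int.cast_natCast] at h
          rw [Nat.cast_add_one, ← add_assoc]
          linear_combination h
        rw [Finset.prod_range_succ, Finset.prod_range_succ]
        linear_combination A (x + k) * ih + (∏ j ∈ Finset.range k, B (x + j)) * h
    exact hstep q

/-- For the special (2,2) configuration `(0,0),(1,0),(0,α),(1,β)` with at least one of
`α, β` rational, no nontrivial measurable solution with minimal decay along integer
translates exists. -/
theorem hrt_minimal_decay_special_two_two_rational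
    (α β : ℝ) (hα : α ≠ 0) (hβ : β ≠ 0)
    (hrat : (∃ q : ℚ, (q : ℝ) = α) ∨ (∃ q : ℚ, (q : ℝ) = β))
    (f : ℝ → ℂ) (hf : Measurable f)
    (d : Fin 4 → ℂ) (hd : ∃ i, d i ≠ 0)
    (heq : ∀ᵐ x : ℝ, d 0 * f x + d 1 * f (x + 1) + d 2 * f x * e (α * x)
      + d 3 * f (x + 1) * e (β * x) = 0)
    (hdecay : ∀ᵐ x : ℝ, Tendsto (fun n : ℤ => f (x + n)) atTop (nhds 0) ∧
      Tendsto (fun n : ℤ => f (x + n)) atBot (nhds 0)) :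
    ∀ᵐ x : ℝ, f x = 0 := by
  rcases hrat with hrat | ⟨r, hr⟩
  · exact ae_eq_zero_of_rational_frequency hα hβ hrat d hd heq hdecay
  have hreflect {p : ℝ → Prop} (hp : ∀ᵐ x, p x) : ∀ᵐ x, p (1 - x) :=
    (Measure.measurePreserving_sub_left volume (1 : ℝ)).quasiMeasurePreserving.ae hp
  have hg : ∀ᵐ x : ℝ, f (1 - x) = 0 := by
    refine ae_eq_zero_of_rational_frequency (α := -β) (β := -α) (f := fun x ↦ f (1 - x))
      (neg_ne_zero.2 hβ) (neg_ne_zero.2 hα) ⟨-r, by simp [hr]⟩ ![d 1, d 0, d 3, d 2] ?_ ?_ ?_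
    · obtain ⟨i, hi⟩ := hd
      fin_cases i
      exacts [⟨1, hi⟩, ⟨0, hi⟩, ⟨3, hi⟩, ⟨2, hi⟩]
    · filter_upwards [(Measure.measurePreserving_neg volume).quasiMeasurePreserving.ae heq] with x hx
      have h₁ : (1 : ℝ) - (x + 1) = -x := by ring
      have h₂ : (1 : ℝ) - x = -x + 1 := by ring
      simp only [h₁, h₂, neg_mul, mul_neg] at hx ⊢
      simp only [Matrix.cons_val]
      linear_combination hx
    · filter_upwards [hreflect hdecay] with x hx
      have h (n : ℤ) : f (1 - (x + n)) = f (1 - x + (-n : ℤ)) := by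
        congr 1
        push_cast; ring
      simp only [h]
      exact ⟨hx.2.comp tendsto_neg_atTop_atBot, hx.1.comp tendsto_neg_atBot_atTop⟩
  filter_upwards [hreflect hg] with x hx
  simpa using hx
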